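/- For every integer n ≥ 1, the abelian complexity of the Tribonacci word satisfies ρ_t(n) = 3 if and only if the normal T-representation ⟨n⟩_T is a prefix of the infinite periodic word 100100100⋯ = (100)^ω. -/

import Mathlib

/-- The m-bonacci substitution on letters. -/
def mbSub (m : ℕ) (ℓ : ℕ) : List ℕ :=
  if ℓ = m - 1 then [0] else [0, ℓ + 1]

/-- Application of the m-bonacci substitution to a word. -/
def mbApply (m : ℕ) (w : List ℕ) : List ℕ := w.flatMap (mbSub m)

/-- σ_m^k(0). -/
def mbIter (m k : ℕ) : List ℕ := (mbApply m)^[k] [0]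

/-- w is a factor of the m-bonacci word. -/
def mbFactor (m : ℕ) (w : List ℕ) : Prop := ∃ k, w <:+: mbIter m k

/-- The prefix of length n of the m-bonacci word. -/
def mbPrefix (m n : ℕ) : List ℕ := (mbIter m n).take n

/-- Abelian complexity: number of distinct Parikh vectors of factors of length n. -/
noncomputable def mbAC (m n : ℕ) : ℕ :=
  Set.ncard ((fun (w : List ℕ) (ℓ : ℕ) => w.count ℓ) ''
    {w : List ℕ | mbFactor m w ∧ w.length = n})

/-- Tribonacci numbers. -/
def tribN : ℕ → ℕ
  | 0 => 0
  | 1 => 0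
  | 2 => 1
  | n + 3 => tribN (n + 2) + tribN (n + 1) + tribN n

/-- Value of a digit string (most significant digit first) in the Tribonacci system. -/
def valT : List ℕ → ℕ
  | [] => 0
  | d :: rest => d * tribN (rest.length + 3) + valT rest

/-- L is the normal T-representation of n (MSB first, greedy). -/
def IsNormalTRep (n : ℕ) (L : List ℕ) : Prop :=
  (∀ d ∈ L, d ≤ 1) ∧ (∀ d ∈ L.take 1, d = 1) ∧ valT L = n ∧
    ∀ S, S <:+ L → valT S < tribN (S.length + 3)

/-- Value of a digit string (MSB first) in the m-bonacci numeration system U_j = |σ_m^j(0)|. -/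
def valU (m : ℕ) : List ℕ → ℕ
  | [] => 0
  | d :: rest => d * (mbIter m rest.length).length + valU m rest

/-- L is the normal U-representation of n (MSB first, greedy) in the m-bonacci system. -/
def IsNormalURep (m n : ℕ) (L : List ℕ) : Prop :=
  (∀ d ∈ L, d ≤ 1) ∧ (∀ d ∈ L.take 1, d = 1) ∧ valU m L = n ∧
    ∀ S, S <:+ L → valU m S < (mbIter m S.length).length

/-! ### The Tribonacci substitution on words -/

lemma mbApply_nil (m : ℕ) : mbApply m [] = [] := rfl

lemma mbApply_cons (m a : ℕ) (u : List ℕ) : mbApply m (a :: u) = mbSub m a ++ mbApply m u := rfl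

lemma mbApply_append (m : ℕ) (u v : List ℕ) :
    mbApply m (u ++ v) = mbApply m u ++ mbApply m v := by
  simp [mbApply]

lemma mbSub_three_two : mbSub 3 2 = [0] := rfl

lemma mbSub_three_of_ne {a : ℕ} (h : a ≠ 2) : mbSub 3 a = [0, a + 1] := by
  simp [mbSub, h]

lemma mbApply_isInfix {m : ℕ} {u v : List ℕ} (h : u <:+: v) : mbApply m u <:+: mbApply m v := by
  obtain ⟨s, t, rfl⟩ := h
  exact ⟨mbApply m s, mbApply m t, by simp [mbApply_append]⟩

lemma mbApply_isPrefix {m : ℕ} {u v : List ℕ} (h : u <+: v) : mbApply m u <+: mbApply m v := by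
  obtain ⟨t, rfl⟩ := h
  exact ⟨mbApply m t, by simp [mbApply_append]⟩

lemma mbIter_succ (m k : ℕ) : mbIter m (k + 1) = mbApply m (mbIter m k) :=
  Function.iterate_succ_apply' _ _ _

lemma count_zero_mbApply (u : List ℕ) : (mbApply 3 u).count 0 = u.length := by
  induction u with
  | nil => rfl
  | cons a u ih =>
    by_cases h : a = 2
    · subst h; simp [mbApply_cons, mbSub_three_two, ih]
    · simp [mbApply_cons, mbSub_three_of_ne h, ih]

lemma count_succ_mbApply {l : ℕ} (hl : l ≠ 2) (u : List ℕ) :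
    (mbApply 3 u).count (l + 1) = u.count l := by
  induction u with
  | nil => rfl
  | cons a u ih =>
    by_cases h : a = 2
    · subst h; simp [mbApply_cons, mbSub_three_two, ih, hl.symm]
    · simp [mbApply_cons, mbSub_three_of_ne h, ih, List.count_cons]

lemma count_one_mbApply (u : List ℕ) : (mbApply 3 u).count 1 = u.count 0 :=
  count_succ_mbApply (by norm_num) u

lemma count_two_mbApply (u : List ℕ) : (mbApply 3 u).count 2 = u.count 1 :=
  count_succ_mbApply (by norm_num) u

lemma length_mbApply_add (u : List ℕ) :
    (mbApply 3 u).length + u.count 2 = 2 * u.length := by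
  induction u with
  | nil => rfl
  | cons a u ih =>
    by_cases h : a = 2
    · subst h; simp [mbApply_cons, mbSub_three_two]; omega
    · simp [mbApply_cons, mbSub_three_of_ne h, h]; omega

/-! ### Desubstitution -/

lemma exists_of_prefix_mbApply (u : List ℕ) : ∀ w : List ℕ, w <+: mbApply 3 u →
    ∃ v r, w = mbApply 3 v ++ r ∧ v <+: u ∧ (r = [] ∨ r = [0]) := by
  induction u with
  | nil =>
    intro w hw
    exact ⟨[], [], by simpa [mbApply_nil] using hw, List.prefix_rfl, Or.inl rfl⟩
  | cons a u ih =>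
    intro w hw
    rw [mbApply_cons] at hw
    by_cases h : a = 2
    · subst h
      rw [mbSub_three_two, List.singleton_append, List.prefix_cons_iff] at hw
      obtain rfl | ⟨w', rfl, hw'⟩ := hw
      · exact ⟨[], [], rfl, List.nil_prefix, Or.inl rfl⟩
      · obtain ⟨v, r, rfl, hv, hr⟩ := ih w' hw'
        exact ⟨2 :: v, r, by simp [mbApply_cons, mbSub_three_two], by simpa using hv, hr⟩
    · rw [mbSub_three_of_ne h, List.cons_append, List.singleton_append, List.prefix_cons_iff] at hw
      obtain rfl | ⟨w', rfl, hw'⟩ := hw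
      · exact ⟨[], [], rfl, List.nil_prefix, Or.inl rfl⟩
      rw [List.prefix_cons_iff] at hw'
      obtain rfl | ⟨w', rfl, hw'⟩ := hw'
      · exact ⟨[], [0], rfl, List.nil_prefix, Or.inr rfl⟩
      · obtain ⟨v, r, rfl, hv, hr⟩ := ih w' hw'
        exact ⟨a :: v, r, by simp [mbApply_cons, mbSub_three_of_ne h], by simpa using hv, hr⟩

lemma exists_of_infix_mbApply (u : List ℕ) : ∀ w : List ℕ, w <:+: mbApply 3 u →
    ∃ v r, (r = [] ∨ r = [0]) ∧ ((w = mbApply 3 v ++ r ∧ v <:+: u) ∨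
      ∃ x, x ≠ 2 ∧ w = (x + 1) :: (mbApply 3 v ++ r) ∧ (x :: v) <:+: u) := by
  induction u with
  | nil =>
    intro w hw
    exact ⟨[], [], Or.inl rfl, Or.inl ⟨by simpa [mbApply_nil] using hw, List.infix_rfl⟩⟩
  | cons a u ih =>
    intro w hw
    have initial_case : w <+: mbApply 3 (a :: u) → ∃ v r, (r = [] ∨ r = [0]) ∧
        ((w = mbApply 3 v ++ r ∧ v <:+: a :: u) ∨
        ∃ x, x ≠ 2 ∧ w = (x + 1) :: (mbApply 3 v ++ r) ∧ (x :: v) <:+: a :: u) := by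
      intro hp
      obtain ⟨v, r, h1, h2, h3⟩ := exists_of_prefix_mbApply _ _ hp
      exact ⟨v, r, h3, Or.inl ⟨h1, h2.isInfix⟩⟩
    have interior_case : w <:+: mbApply 3 u → ∃ v r, (r = [] ∨ r = [0]) ∧
        ((w = mbApply 3 v ++ r ∧ v <:+: a :: u) ∨
        ∃ x, x ≠ 2 ∧ w = (x + 1) :: (mbApply 3 v ++ r) ∧ (x :: v) <:+: a :: u) := by
      intro hp
      obtain ⟨v, r, hr, ⟨h1, h2⟩ | ⟨x, hx, h1, h2⟩⟩ := ih w hp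
      · exact ⟨v, r, hr, Or.inl ⟨h1, List.infix_cons h2⟩⟩
      · exact ⟨v, r, hr, Or.inr ⟨x, hx, h1, List.infix_cons h2⟩⟩
    by_cases h : a = 2
    · subst h
      have hw' := hw
      rw [mbApply_cons, mbSub_three_two, List.singleton_append, List.infix_cons_iff] at hw'
      exact hw'.elim initial_case interior_case
    · have hw' := hw
      rw [mbApply_cons, mbSub_three_of_ne h, List.cons_append, List.singleton_append,
        List.infix_cons_iff, List.infix_cons_iff, List.prefix_cons_iff (a := a + 1)] at hw'
      obtain hp | (rfl | ⟨w', rfl, hp⟩) | hp := hw'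
      · exact initial_case (by simpa [mbApply_cons, mbSub_three_of_ne h] using hp)
      · exact initial_case List.nil_prefix
      · obtain ⟨v, r, rfl, hv, hr⟩ := exists_of_prefix_mbApply _ _ hp
        exact ⟨v, r, hr, Or.inr ⟨a, h, rfl, ((List.prefix_cons_inj a).2 hv).isInfix⟩⟩
      · exact interior_case hp

/-! ### Factors and prefixes of the Tribonacci word -/

/-- `w` is a prefix of the m-bonacci word. -/
def IsMbPrefix (m : ℕ) (w : List ℕ) : Prop := ∃ k, w <+: mbIter m k

lemma mbFactor.mono {m : ℕ} {u w : List ℕ} (hw : mbFactor m w) (h : u <:+: w) :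
    mbFactor m u :=
  let ⟨k, hk⟩ := hw
  ⟨k, h.trans hk⟩

lemma mbFactor.apply {m : ℕ} {w : List ℕ} (hw : mbFactor m w) : mbFactor m (mbApply m w) :=
  let ⟨k, hk⟩ := hw
  ⟨k + 1, by rw [mbIter_succ]; exact mbApply_isInfix hk⟩

lemma mbIter_three_succ_eq (k : ℕ) : ∃ s, s ≠ [] ∧ mbIter 3 (k + 1) = mbIter 3 k ++ s := by
  induction k with
  | zero => exact ⟨[1], by simp, rfl⟩
  | succ k ih =>
    obtain ⟨s, hs, h⟩ := ih
    refine ⟨mbApply 3 s, ?_, ?_⟩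
    · obtain ⟨a, s, rfl⟩ := List.exists_cons_of_ne_nil hs
      simp only [mbApply_cons, mbSub]
      split_ifs <;> simp
    · rw [mbIter_succ, h, mbApply_append, ← mbIter_succ, ← h]

lemma le_length_mbIter (k : ℕ) : k < (mbIter 3 k).length := by
  induction k with
  | zero => simp [mbIter]
  | succ k ih =>
    obtain ⟨s, hs, h⟩ := mbIter_three_succ_eq k
    have := List.length_pos_iff.2 hs
    rw [h, List.length_append]
    omega

lemma mbFactor.exists_append_singleton {w : List ℕ} (hw : mbFactor 3 w) :
    ∃ y, mbFactor 3 (w ++ [y]) := by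
  obtain ⟨k, s, t, h⟩ := hw
  obtain ⟨r, hr, h'⟩ := mbIter_three_succ_eq k
  have hne : t ++ r ≠ [] := by simp [hr]
  obtain ⟨y, z, hyz⟩ := List.exists_cons_of_ne_nil hne
  refine ⟨y, k + 1, s, z, ?_⟩
  rw [h', ← h]
  simp [hyz]

lemma mbFactor.exists_append {w : List ℕ} (hw : mbFactor 3 w) (j : ℕ) :
    ∃ g : List ℕ, g.length = j ∧ mbFactor 3 (w ++ g) := by
  induction j with
  | zero => exact ⟨[], rfl, by simpa using hw⟩
  | succ j ih =>
    obtain ⟨g, hg, h⟩ := ih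
    obtain ⟨y, hy⟩ := h.exists_append_singleton
    exact ⟨g ++ [y], by simp [hg], by simpa using hy⟩

lemma IsMbPrefix.exists_append_singleton {w : List ℕ} (hw : IsMbPrefix 3 w) :
    ∃ y, IsMbPrefix 3 (w ++ [y]) := by
  obtain ⟨k, t, h⟩ := hw
  obtain ⟨r, hr, h'⟩ := mbIter_three_succ_eq k
  have hne : t ++ r ≠ [] := by simp [hr]
  obtain ⟨y, z, hyz⟩ := List.exists_cons_of_ne_nil hne
  refine ⟨y, k + 1, z, ?_⟩
  rw [h', ← h]
  simp [hyz]

lemma IsMbPrefix.mbApply_append_zero {w : List ℕ} (hw : IsMbPrefix 3 w) :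
    IsMbPrefix 3 (mbApply 3 w ++ [0]) := by
  obtain ⟨y, k, hk⟩ := hw.exists_append_singleton
  refine ⟨k + 1, ?_⟩
  rw [mbIter_succ]
  refine List.IsPrefix.trans ?_ (mbApply_isPrefix hk)
  by_cases h : y = 2
  · subst h; simp [mbApply_append, mbApply_cons, mbApply_nil, mbSub_three_two]
  · simp [mbApply_append, mbApply_cons, mbApply_nil, mbSub_three_of_ne h]

lemma exists_isMbPrefix_length (n : ℕ) : ∃ q, IsMbPrefix 3 q ∧ q.length = n :=
  ⟨(mbIter 3 n).take n, ⟨n, List.take_prefix _ _⟩, by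
    have := le_length_mbIter n
    simp; omega⟩

lemma mem_mbIter_three_lt (k : ℕ) : ∀ a ∈ mbIter 3 k, a < 3 := by
  induction k with
  | zero => simp [mbIter]
  | succ k ih =>
    intro a ha
    rw [mbIter_succ, mbApply, List.mem_flatMap] at ha
    obtain ⟨b, hb, ha⟩ := ha
    have := ih b hb
    simp only [mbSub] at ha
    split_ifs at ha <;> simp at ha <;> omega

lemma mbFactor.lt_three {w : List ℕ} (hw : mbFactor 3 w) : ∀ a ∈ w, a < 3 := by
  obtain ⟨k, hk⟩ := hw
  exact fun a ha => mem_mbIter_three_lt k a (hk.subset ha)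

lemma length_eq_count_of_lt_three {w : List ℕ} (hw : ∀ a ∈ w, a < 3) :
    w.length = w.count 0 + w.count 1 + w.count 2 := by
  induction w with
  | nil => rfl
  | cons a w ih =>
    have h := ih fun b hb => hw b (List.mem_cons_of_mem _ hb)
    have ha := hw a List.mem_cons_self
    interval_cases a <;> simp <;> omega

lemma mbFactor.length_eq {w : List ℕ} (hw : mbFactor 3 w) :
    w.length = w.count 0 + w.count 1 + w.count 2 :=
  length_eq_count_of_lt_three hw.lt_three

lemma mbFactor.count_eq_zero {w : List ℕ} (hw : mbFactor 3 w) {l : ℕ} (hl : 3 ≤ l) :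
    w.count l = 0 :=
  List.count_eq_zero.2 fun h => absurd (hw.lt_three l h) (by omega)

lemma IsMbPrefix.isFactor {m : ℕ} {w : List ℕ} (hw : IsMbPrefix m w) : mbFactor m w :=
  let ⟨k, hk⟩ := hw
  ⟨k, hk.isInfix⟩

lemma IsMbPrefix.mono {m : ℕ} {u w : List ℕ} (hw : IsMbPrefix m w) (h : u <+: w) :
    IsMbPrefix m u :=
  let ⟨k, hk⟩ := hw
  ⟨k, h.trans hk⟩

/-- Every `σ^k(0)` is left special, with all three left extensions. -/
lemma mbFactor_cons_mbIter (k : ℕ) :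
    mbFactor 3 (0 :: mbIter 3 k) ∧ mbFactor 3 (1 :: mbIter 3 k) ∧
      mbFactor 3 (2 :: mbIter 3 k) := by
  induction k with
  | zero => exact ⟨⟨4, by decide⟩, ⟨4, by decide⟩, ⟨4, by decide⟩⟩
  | succ k ih =>
    obtain ⟨h0, h1, h2⟩ := ih
    rw [mbIter_succ]
    exact ⟨h2.apply, h0.apply.mono (List.suffix_cons _ _).isInfix,
      h1.apply.mono (List.suffix_cons _ _).isInfix⟩

lemma IsMbPrefix.mbFactor_cons {q : List ℕ} (hq : IsMbPrefix 3 q) {x : ℕ} (hx : x < 3) :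
    mbFactor 3 (x :: q) := by
  obtain ⟨k, hk⟩ := hq
  obtain ⟨h0, h1, h2⟩ := mbFactor_cons_mbIter k
  have h : x :: q <:+: x :: mbIter 3 k := ((List.prefix_cons_inj x).2 hk).isInfix
  interval_cases x
  · exact h0.mono h
  · exact h1.mono h
  · exact h2.mono h

lemma IsMbPrefix.mbFactor_zero_cons_cons {q : List ℕ} (hq : IsMbPrefix 3 q) {x : ℕ} (hx : x < 2) :
    mbFactor 3 (0 :: (x + 1) :: q) := by
  obtain ⟨k, hk⟩ := hq
  have h : mbFactor 3 (0 :: (x + 1) :: mbIter 3 (k + 1)) := by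
    have := (IsMbPrefix.mbFactor_cons ⟨k, List.prefix_rfl⟩ (by omega : x < 3)).apply
    rwa [mbApply_cons, mbSub_three_of_ne (by omega), ← mbIter_succ] at this
  obtain ⟨s, -, hs⟩ := mbIter_three_succ_eq k
  refine h.mono (List.IsPrefix.isInfix ?_)
  simpa [hs] using hk.trans (List.prefix_append _ s)

lemma IsMbPrefix.exists_of_append_zero {q : List ℕ} (hq : IsMbPrefix 3 (q ++ [0])) :
    ∃ v, IsMbPrefix 3 v ∧ q = mbApply 3 v := by
  obtain ⟨k, hk⟩ := hq
  obtain ⟨s, -, hs⟩ := mbIter_three_succ_eq k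
  have hk' : q ++ [0] <+: mbApply 3 (mbIter 3 k) := by
    rw [← mbIter_succ, hs]
    exact hk.trans (List.prefix_append _ s)
  obtain ⟨v, r, h, hv, rfl | rfl⟩ := exists_of_prefix_mbApply _ _ hk'
  · rcases List.eq_nil_or_concat' v with rfl | ⟨v, a, rfl⟩
    · simp [mbApply_nil] at h
    by_cases ha : a = 2
    · subst ha
      refine ⟨v, ⟨k, (List.prefix_append _ _).trans hv⟩, ?_⟩
      simpa [mbApply_append, mbApply_cons, mbApply_nil, mbSub_three_two] using h
    · have := congrArg List.getLast? h
      simp [mbApply_append, mbApply_cons, mbApply_nil, mbSub_three_of_ne ha] at this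
  · exact ⟨v, ⟨k, hv⟩, by simpa using h⟩

/-! ### Prefixes dominated by all longer factors -/

/-- Every factor of length `|q| + 1` contains at least as many copies of each letter as `q`. -/
def IsDominated (q : List ℕ) : Prop :=
  ∀ w, mbFactor 3 w → w.length = q.length + 1 →
    q.count 0 ≤ w.count 0 ∧ q.count 1 ≤ w.count 1 ∧ q.count 2 ≤ w.count 2

/-- Some factor of length `|q| + 1` has Parikh vector `Ψ(q) + (1, 1, 1) - 2 e_j`. -/
def HasDefect (q : List ℕ) : Prop :=
  ∃ w, mbFactor 3 w ∧
    ((w.count 0 = q.count 0 + 1 ∧ w.count 1 + 1 = q.count 1 ∧ w.count 2 = q.count 2 + 1) ∨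
     (w.count 0 = q.count 0 + 1 ∧ w.count 1 = q.count 1 + 1 ∧ w.count 2 + 1 = q.count 2) ∨
     (w.count 0 + 1 = q.count 0 ∧ w.count 1 = q.count 1 + 1 ∧ w.count 2 = q.count 2 + 1))

lemma IsDominated.of_le_length {q w : List ℕ} (hq : IsDominated q) (hw : mbFactor 3 w)
    (h : q.length + 1 ≤ w.length) :
    q.count 0 ≤ w.count 0 ∧ q.count 1 ≤ w.count 1 ∧ q.count 2 ≤ w.count 2 := by
  have hp := List.take_prefix (q.length + 1) w
  obtain ⟨h0, h1, h2⟩ := hq _ (hw.mono hp.isInfix) (by simp; omega)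
  have hs := hp.sublist
  exact ⟨h0.trans (hs.count_le _), h1.trans (hs.count_le _), h2.trans (hs.count_le _)⟩

lemma IsDominated.exists_add {q w : List ℕ} (hq : IsDominated q) (hw : mbFactor 3 w) :
    ∃ a b c : ℕ, w.length + (a + b + c) = max w.length (q.length + 1) ∧
      q.count 0 ≤ w.count 0 + a ∧ q.count 1 ≤ w.count 1 + b ∧ q.count 2 ≤ w.count 2 + c := by
  obtain ⟨g, hg, h⟩ := hw.exists_append (q.length + 1 - w.length)
  have hl := (h.mono (List.suffix_append w g).isInfix).length_eq
  have := hq.of_le_length h (by simp; omega)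
  simp only [List.count_append] at this
  exact ⟨g.count 0, g.count 1, g.count 2, by omega, this⟩

lemma IsDominated.mbApply_append_zero {q : List ℕ} (hq : IsDominated q)
    (hf : mbFactor 3 q) : IsDominated (mbApply 3 q ++ [0]) := by
  rintro w ⟨k, hk⟩ hl
  obtain ⟨s, -, hs⟩ := mbIter_three_succ_eq k
  have hk' : w <:+: mbApply 3 (mbIter 3 k) := by
    rw [← mbIter_succ, hs]
    exact hk.trans (List.prefix_append _ s).isInfix
  have hlq := hf.length_eq
  have hlm := length_mbApply_add q
  simp only [List.length_append, List.length_singleton] at hl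
  simp only [List.count_append, count_zero_mbApply, count_one_mbApply, count_two_mbApply,
    List.count_singleton_self, List.count_singleton]
  obtain ⟨v, r, hr, ⟨rfl, hv⟩ | ⟨x, hx, rfl, hv⟩⟩ := exists_of_infix_mbApply _ _ hk'
  · have hvf : mbFactor 3 v := ⟨k, hv⟩
    have hlv := hvf.length_eq
    have hlmv := length_mbApply_add v
    obtain ⟨a, b, c, habc⟩ := hq.exists_add hvf
    obtain rfl | rfl := hr <;>
    · simp [count_zero_mbApply, count_one_mbApply, count_two_mbApply] at hl ⊢
      omega
  · have hvf : mbFactor 3 (x :: v) := ⟨k, hv⟩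
    have hlv := hvf.length_eq
    have hlmv := length_mbApply_add v
    have hx3 := hvf.lt_three x List.mem_cons_self
    obtain ⟨a, b, c, habc⟩ := hq.exists_add hvf
    obtain rfl | rfl : x = 0 ∨ x = 1 := by omega
    all_goals
      obtain rfl | rfl := hr <;>
      · simp [count_zero_mbApply, count_one_mbApply, count_two_mbApply] at hl hlv habc ⊢
        omega

lemma HasDefect.mbApply_append_zero {q : List ℕ} (hq : HasDefect q) (hf : mbFactor 3 q) :
    HasDefect (mbApply 3 q ++ [0]) := by
  obtain ⟨w, hw, h⟩ := hq
  have hlq := hf.length_eq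
  have hlw := hw.length_eq
  obtain ⟨y, hy⟩ := hw.exists_append_singleton
  have hw0 : mbFactor 3 (mbApply 3 w ++ [0]) := by
    refine hy.apply.mono (List.IsPrefix.isInfix ?_)
    by_cases h : y = 2
    · subst h; simp [mbApply_append, mbApply_cons, mbApply_nil, mbSub_three_two]
    · simp [mbApply_append, mbApply_cons, mbApply_nil, mbSub_three_of_ne h]
  obtain h | h | h := h
  · refine ⟨_, hw0, Or.inr (Or.inl ?_)⟩
    simp [count_zero_mbApply, count_one_mbApply, count_two_mbApply]
    omega
  · have hne : w ≠ [] := by rintro rfl; simp at h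
    obtain ⟨z, hz⟩ : ∃ z, mbApply 3 w = 0 :: z := by
      obtain ⟨a, u, rfl⟩ := List.exists_cons_of_ne_nil hne
      rw [mbApply_cons, mbSub]
      split_ifs <;> simp
    have hc0 := count_zero_mbApply w
    have hc1 := count_one_mbApply w
    have hc2 := count_two_mbApply w
    rw [hz] at hc0 hc1 hc2
    have hzf : mbFactor 3 z := hw.apply.mono (by rw [hz]; exact (List.suffix_cons _ _).isInfix)
    refine ⟨z, hzf, Or.inr (Or.inr ?_)⟩
    simp [count_zero_mbApply, count_one_mbApply, count_two_mbApply] at hc0 hc1 hc2 ⊢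
    omega
  · refine ⟨_, hw0, Or.inl ?_⟩
    simp [count_zero_mbApply, count_one_mbApply, count_two_mbApply]
    omega

/-- The bispecial prefixes of the Tribonacci word. -/
def tribBispecial : ℕ → List ℕ
  | 0 => []
  | k + 1 => mbApply 3 (tribBispecial k) ++ [0]

lemma isMbPrefix_tribBispecial (k : ℕ) : IsMbPrefix 3 (tribBispecial k) := by
  induction k with
  | zero => exact ⟨0, List.nil_prefix⟩
  | succ k ih => exact ih.mbApply_append_zero

lemma isDominated_tribBispecial (k : ℕ) : IsDominated (tribBispecial k) := by
  induction k with
  | zero => intro w _ _; simp [tribBispecial]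
  | succ k ih => exact ih.mbApply_append_zero (isMbPrefix_tribBispecial k).isFactor

lemma IsMbPrefix.eq_tribBispecial_or_hasDefect {q : List ℕ} (hq : IsMbPrefix 3 q) :
    (∃ k, q = tribBispecial k) ∨ HasDefect q := by
  induction hn : q.length using Nat.strong_induction_on generalizing q with
  | _ n ih =>
    rcases List.eq_nil_or_concat' q with rfl | ⟨p, a, rfl⟩
    · exact Or.inl ⟨0, rfl⟩
    have hp : IsMbPrefix 3 p := hq.mono (List.prefix_append _ _)
    have ha : a < 3 := hq.isFactor.lt_three a (by simp)
    interval_cases a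
    · obtain ⟨v, hv, rfl⟩ := hq.exists_of_append_zero
      have hlt : v.length < n := by
        have := length_mbApply_add v
        have := List.count_le_length (a := 2) (l := v)
        simp at hn
        omega
      obtain ⟨k, rfl⟩ | h := ih _ hlt hv rfl
      · exact Or.inl ⟨k + 1, rfl⟩
      · exact Or.inr (h.mbApply_append_zero hv.isFactor)
    · exact Or.inr ⟨0 :: 2 :: p, hp.mbFactor_zero_cons_cons (x := 1) (by norm_num),
        Or.inl (by simp)⟩
    · exact Or.inr ⟨0 :: 1 :: p, hp.mbFactor_zero_cons_cons (x := 0) (by norm_num),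
        Or.inr (Or.inl (by simp))⟩

/-! ### The abelian complexity -/

/-- The Parikh vector of a word over `ℕ`. -/
abbrev parikh (w : List ℕ) (l : ℕ) : ℕ := w.count l

lemma parikh_cons_ne {x y : ℕ} (h : x ≠ y) (q : List ℕ) : parikh (x :: q) ≠ parikh (y :: q) := by
  intro he
  have := congrFun he x
  simp [parikh, h.symm] at this

lemma mbAC_eq_three_of_isDominated {q : List ℕ} (hq : IsMbPrefix 3 q) (hd : IsDominated q) :
    mbAC 3 (q.length + 1) = 3 := by
  refine Set.ncard_eq_three.2 ⟨parikh (0 :: q), parikh (1 :: q), parikh (2 :: q),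
    parikh_cons_ne (by norm_num) q, parikh_cons_ne (by norm_num) q,
    parikh_cons_ne (by norm_num) q, Set.Subset.antisymm ?_ ?_⟩
  · rintro _ ⟨w, ⟨hw, hl⟩, rfl⟩
    have h := hd w hw hl
    have hlw := hw.length_eq
    have hlq := hq.isFactor.length_eq
    have eq_of {x : ℕ} (hx : x < 3) (h0 : w.count 0 = (x :: q).count 0)
        (h1 : w.count 1 = (x :: q).count 1) (h2 : w.count 2 = (x :: q).count 2) :
        (fun l => w.count l) = parikh (x :: q) := by
      funext l
      by_cases hl3 : 3 ≤ l
      · rw [parikh, hw.count_eq_zero hl3, (hq.mbFactor_cons hx).count_eq_zero hl3]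
      · have : l < 3 := by omega
        interval_cases l <;> assumption
    have hcases : w.count 0 = q.count 0 + 1 ∨ w.count 1 = q.count 1 + 1 ∨
        w.count 2 = q.count 2 + 1 := by omega
    obtain hc | hc | hc := hcases
    · exact Or.inl (eq_of (by norm_num) (by simp; omega) (by simp; omega) (by simp; omega))
    · exact Or.inr (Or.inl (eq_of (by norm_num) (by simp; omega) (by simp; omega)
        (by simp; omega)))
    · exact Or.inr (Or.inr (eq_of (by norm_num) (by simp; omega) (by simp; omega)
        (by simp; omega)))
  · rintro _ (rfl | rfl | rfl)
    · exact ⟨0 :: q, ⟨hq.mbFactor_cons (by norm_num), by simp⟩, rfl⟩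
    · exact ⟨1 :: q, ⟨hq.mbFactor_cons (by norm_num), by simp⟩, rfl⟩
    · exact ⟨2 :: q, ⟨hq.mbFactor_cons (by norm_num), by simp⟩, rfl⟩

lemma mbAC_ne_three_of_hasDefect {q : List ℕ} (hq : IsMbPrefix 3 q) (hd : HasDefect q) :
    mbAC 3 (q.length + 1) ≠ 3 := by
  intro h3
  obtain ⟨x, y, z, -, -, -, hs⟩ := Set.ncard_eq_three.1 h3
  obtain ⟨w, hw, h⟩ := hd
  have hlw := hw.length_eq
  have hlq := hq.isFactor.length_eq
  have hmem {u : List ℕ} (hu : mbFactor 3 u) (hl : u.length = q.length + 1) :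
      parikh u = x ∨ parikh u = y ∨ parikh u = z := by
    have : parikh u ∈ ({x, y, z} : Set (ℕ → ℕ)) := hs ▸ ⟨u, ⟨hu, hl⟩, rfl⟩
    simpa using this
  have hne {a : ℕ} (ha : a < 3) : parikh w ≠ parikh (a :: q) := by
    intro he
    have h0 := congrFun he 0
    have h1 := congrFun he 1
    have h2 := congrFun he 2
    interval_cases a <;> simp only [parikh, List.count_cons] at h0 h1 h2 <;> norm_num at h0 h1 h2 <;>
      omega
  have m0 := hmem (hq.mbFactor_cons (x := 0) (by norm_num)) (by simp)
  have m1 := hmem (hq.mbFactor_cons (x := 1) (by norm_num)) (by simp)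
  have m2 := hmem (hq.mbFactor_cons (x := 2) (by norm_num)) (by simp)
  have mw := hmem hw (by omega)
  have n0 := hne (a := 0) (by norm_num)
  have n1 := hne (a := 1) (by norm_num)
  have n2 := hne (a := 2) (by norm_num)
  have n01 := parikh_cons_ne (x := 0) (y := 1) (by norm_num) q
  have n02 := parikh_cons_ne (x := 0) (y := 2) (by norm_num) q
  have n12 := parikh_cons_ne (x := 1) (y := 2) (by norm_num) q
  generalize parikh w = d at *
  generalize parikh (0 :: q) = a at *
  generalize parikh (1 :: q) = b at *
  generalize parikh (2 :: q) = c at *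
  grind

lemma mbAC_eq_three_iff_exists_tribBispecial {n : ℕ} (hn : 1 ≤ n) :
    mbAC 3 n = 3 ↔ ∃ k, n = (tribBispecial k).length + 1 := by
  constructor
  · intro h
    obtain ⟨q, hq, hl⟩ := exists_isMbPrefix_length (n - 1)
    obtain rfl : n = q.length + 1 := by omega
    obtain ⟨k, rfl⟩ | hd := hq.eq_tribBispecial_or_hasDefect
    · exact ⟨k, rfl⟩
    · exact absurd h (mbAC_ne_three_of_hasDefect hq hd)
  · rintro ⟨k, rfl⟩
    exact mbAC_eq_three_of_isDominated (isMbPrefix_tribBispecial k) (isDominated_tribBispecial k)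

/-! ### Tribonacci representations -/

lemma tribN_add_three (n : ℕ) : tribN (n + 3) = tribN (n + 2) + tribN (n + 1) + tribN n := rfl

lemma tribN_mono : Monotone tribN := by
  refine monotone_nat_of_le_succ fun n => ?_
  match n with
  | 0 => simp [tribN]
  | 1 => simp [tribN]
  | n + 2 => rw [tribN_add_three n]; omega

lemma length_tribBispecial_succ (k : ℕ) :
    (tribBispecial (k + 1)).length = (tribBispecial k).length + tribN (k + 3) := by
  have hrec (k : ℕ) : (tribBispecial (k + 1)).count 0 = (tribBispecial k).length + 1 ∧
      (tribBispecial (k + 1)).count 1 = (tribBispecial k).count 0 ∧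
      (tribBispecial (k + 1)).count 2 = (tribBispecial k).count 1 := by
    simp [tribBispecial, count_zero_mbApply, count_one_mbApply, count_two_mbApply]
  have hlen (k : ℕ) := (isMbPrefix_tribBispecial k).isFactor.length_eq
  induction k using Nat.strong_induction_on with
  | _ k ih =>
    match k with
    | 0 => rfl
    | 1 => rfl
    | 2 => rfl
    | k + 3 =>
      have := ih k (by omega)
      have := ih (k + 1) (by omega)
      have := ih (k + 2) (by omega)
      have := tribN_add_three (k + 3)
      have := hrec k
      have := hrec (k + 1)
      have := hrec (k + 2)
      have := hrec (k + 3)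
      have := hlen (k + 2)
      have := hlen (k + 3)
      have := hlen (k + 4)
      simp only [add_assoc, Nat.reduceAdd] at *
      omega

lemma length_tribBispecial_add_three (k : ℕ) :
    (tribBispecial (k + 3)).length = (tribBispecial k).length + tribN (k + 6) := by
  have := length_tribBispecial_succ k
  have := length_tribBispecial_succ (k + 1)
  have := length_tribBispecial_succ (k + 2)
  have := tribN_add_three (k + 3)
  simp only [add_assoc, Nat.reduceAdd] at *
  omega

/-- The prefix of length `m` of the periodic word `(100)^ω`. -/
def periodicPrefix : ℕ → List ℕ
  | 0 => []
  | 1 => [1]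
  | 2 => [1, 0]
  | m + 3 => 1 :: 0 :: 0 :: periodicPrefix m

lemma length_periodicPrefix : ∀ m, (periodicPrefix m).length = m
  | 0 => rfl
  | 1 => rfl
  | 2 => rfl
  | m + 3 => by simp [periodicPrefix, length_periodicPrefix m]

lemma valT_periodicPrefix_succ :
    ∀ m, valT (periodicPrefix (m + 1)) = (tribBispecial m).length + 1
  | 0 => rfl
  | 1 => rfl
  | 2 => rfl
  | m + 3 => by
    have h := length_tribBispecial_add_three m
    have hv := valT_periodicPrefix_succ m
    simp only [periodicPrefix, valT, List.length_cons, length_periodicPrefix] at hv ⊢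
    simp only [add_assoc, Nat.reduceAdd] at *
    omega

lemma exists_isPrefix_replicate_iff (L : List ℕ) :
    (∃ k, L <+: (List.replicate k [1, 0, 0]).flatten) ↔ L = periodicPrefix L.length := by
  constructor
  · rintro ⟨k, hk⟩
    induction k generalizing L with
    | zero =>
      obtain rfl : L = [] := by simpa using hk
      rfl
    | succ k ih =>
      simp only [List.replicate_succ, List.flatten_cons, List.cons_append, List.nil_append,
        List.prefix_cons_iff] at hk
      obtain rfl | ⟨_, rfl, rfl | ⟨_, rfl, rfl | ⟨L, rfl, hL⟩⟩⟩ := hk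
      · rfl
      · rfl
      · rfl
      · simpa [periodicPrefix] using ih L hL
  · intro h
    have hp (m : ℕ) : periodicPrefix m <+: (List.replicate m [1, 0, 0]).flatten := by
      induction m using periodicPrefix.induct with
      | case1 => decide
      | case2 => decide
      | case3 => decide
      | case4 m ih =>
        have : (List.replicate m [1, 0, 0]).flatten <+:
            (List.replicate (m + 2) [1, 0, 0]).flatten := by
          rw [List.replicate_add, List.flatten_append]
          exact List.prefix_append _ _
        simpa [periodicPrefix, List.replicate_succ (n := m + 2)] using ih.trans this
    exact ⟨L.length, h ▸ by simpa [length_periodicPrefix] using hp L.length⟩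

/-- The greedy condition on digit strings of the Tribonacci system. -/
def IsGreedyT (L : List ℕ) : Prop := ∀ S, S <:+ L → valT S < tribN (S.length + 3)

lemma isGreedyT_cons {d : ℕ} {L : List ℕ} :
    IsGreedyT (d :: L) ↔ valT (d :: L) < tribN (L.length + 4) ∧ IsGreedyT L := by
  simp only [IsGreedyT, List.suffix_cons_iff]
  constructor
  · exact fun h => ⟨h _ (Or.inl rfl), fun S hS => h S (Or.inr hS)⟩
  · rintro ⟨h1, h2⟩ S (rfl | hS)
    · exact h1
    · exact h2 S hS

lemma isGreedyT_zero_cons {L : List ℕ} (h : IsGreedyT L) : IsGreedyT (0 :: L) := by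
  refine isGreedyT_cons.2 ⟨?_, h⟩
  have := h L List.suffix_rfl
  have : tribN (L.length + 3) ≤ tribN (L.length + 4) := tribN_mono (by omega)
  simp only [valT]
  omega

lemma isGreedyT_nil : IsGreedyT [] := by
  intro S hS
  obtain rfl : S = [] := by simpa using hS
  decide

lemma isGreedyT_periodicPrefix : ∀ m, IsGreedyT (periodicPrefix m)
  | 0 => isGreedyT_nil
  | 1 => isGreedyT_cons.2 ⟨by decide, isGreedyT_nil⟩
  | 2 => isGreedyT_cons.2 ⟨by decide, isGreedyT_zero_cons isGreedyT_nil⟩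
  | m + 3 => by
    have ih := isGreedyT_periodicPrefix m
    refine isGreedyT_cons.2 ⟨?_, isGreedyT_zero_cons (isGreedyT_zero_cons ih)⟩
    have h := ih _ List.suffix_rfl
    simp only [valT, List.length_cons, length_periodicPrefix] at h ⊢
    have h1 := tribN_add_three (m + 3)
    simp only [add_assoc, Nat.reduceAdd] at *
    omega

lemma IsGreedyT.eq_of_length_eq {L M : List ℕ} (hL : IsGreedyT L) (hM : IsGreedyT M)
    (hlen : L.length = M.length) (hval : valT L = valT M) : L = M := by
  induction L generalizing M with
  | nil => exact (List.length_eq_zero_iff.1 hlen.symm).symm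
  | cons d L ih =>
    cases M with
    | nil => simp at hlen
    | cons e M =>
      have hlen' : L.length = M.length := by simpa using hlen
      have hL' := (isGreedyT_cons.1 hL).2
      have hM' := (isGreedyT_cons.1 hM).2
      have h1 := hL' L List.suffix_rfl
      have h2 := hM' M List.suffix_rfl
      simp only [valT, ← hlen'] at hval h2
      have hT : 0 < tribN (L.length + 3) := by omega
      have hde : d = e := by
        have := congrArg (· / tribN (L.length + 3)) hval
        simpa [Nat.mul_comm _ (tribN _), Nat.mul_add_div hT, Nat.div_eq_of_lt h1,
          Nat.div_eq_of_lt h2] using this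
      subst hde
      rw [ih hL' hM' hlen' (by omega)]

lemma IsGreedyT.length_le {L M : List ℕ} (hL : IsGreedyT L) (hM : ∀ d ∈ M.take 1, d = 1)
    (hval : valT L = valT M) : M.length ≤ L.length := by
  by_contra! hlt
  cases M with
  | nil => simp at hlt
  | cons e M =>
    obtain rfl : e = 1 := by simpa using hM
    have h1 := hL L List.suffix_rfl
    have h2 : tribN (L.length + 3) ≤ tribN (M.length + 3) :=
      tribN_mono (by simp at hlt; omega)
    simp only [valT] at hval
    omega

lemma take_one_periodicPrefix (m : ℕ) : ∀ d ∈ (periodicPrefix m).take 1, d = 1 := by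
  match m with
  | 0 => simp [periodicPrefix]
  | 1 => simp [periodicPrefix]
  | 2 => simp [periodicPrefix]
  | m + 3 => simp [periodicPrefix]

lemma IsNormalTRep.eq_periodicPrefix_iff {n : ℕ} (hn : 1 ≤ n) {L : List ℕ}
    (hL : IsNormalTRep n L) :
    L = periodicPrefix L.length ↔ ∃ k, n = (tribBispecial k).length + 1 := by
  obtain ⟨-, hlead, rfl, hgreedy⟩ := hL
  constructor
  · intro h
    obtain ⟨k, hk⟩ : ∃ k, L.length = k + 1 := by
      refine Nat.exists_eq_succ_of_ne_zero fun h0 => ?_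
      obtain rfl := List.length_eq_zero_iff.1 h0
      simp [valT] at hn
    refine ⟨k, ?_⟩
    rw [h, hk, valT_periodicPrefix_succ]
  · rintro ⟨k, hk⟩
    have hval := hk.trans (valT_periodicPrefix_succ k).symm
    have hP := isGreedyT_periodicPrefix (k + 1)
    have hlen := le_antisymm (hP.length_le hlead hval.symm)
      (IsGreedyT.length_le hgreedy (take_one_periodicPrefix (k + 1)) hval)
    rw [IsGreedyT.eq_of_length_eq hgreedy hP hlen hval, length_periodicPrefix]

theorem tribonacci_abelian_complexity_eq_three_iff (n : ℕ) (hn : 1 ≤ n)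
    (L : List ℕ) (hL : IsNormalTRep n L) :
    mbAC 3 n = 3 ↔ ∃ k, L <+: (List.replicate k [1, 0, 0]).flatten := by
  rw [mbAC_eq_three_iff_exists_tribBispecial hn, exists_isPrefix_replicate_iff,
    hL.eq_periodicPrefix_iff hn]
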